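/- arXiv:0709.1589 — 2 statements merged into one kernel-verified Lean document; each statement's English description precedes it below -/
import Mathlib

section
/- In an arbitrage-free discrete market model with proportional transaction costs, for an American option with adapted ℝ²-valued payoff (ξ,ζ), there exist a self-financing strategy (α,β) with (α_0,β_0) = (−π^b(ξ,ζ), 0) and a pure stopping time τ such that θ_τ(α_τ + ξ_τ, β_τ + ζ_τ) ≥ 0; in particular the supremum in the definition of π^b(ξ,ζ) is attained (by this strategy, for which θ_0(−α_0,−β_0) = π^b(ξ,ζ)). -/
open MeasureTheory
open scoped Pointwise

noncomputable section

namespace RZ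

variable {Ω : Type*} [Fintype Ω]

/-- `ω` and `ω'` lie in the same atom of the σ-field `m`. -/
def sameAtom (m : MeasurableSpace Ω) (ω ω' : Ω) : Prop :=
  ∀ A : Set Ω, MeasurableSet[m] A → (ω ∈ A ↔ ω' ∈ A)

/-- Elementary conditional expectation w.r.t. a σ-field on a finite space:
at `ω` it is the `P`-average of `f` over the atom of `ω`. -/
def condExp (m : MeasurableSpace Ω) (P : Ω → ℝ) (f : Ω → ℝ) (ω : Ω) : ℝ :=
  (∑ ω' : Ω, Set.indicator {ω'' | sameAtom m ω ω''} (fun ω'' => P ω'' * f ω'') ω') /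
  (∑ ω' : Ω, Set.indicator {ω'' | sameAtom m ω ω''} P ω')

/-- Expectation under `P`. -/
def expect (P : Ω → ℝ) (f : Ω → ℝ) : ℝ := ∑ ω : Ω, P ω * f ω

/-- Discrete market model with proportional transaction costs. -/
structure Market (Ω : Type*) [Fintype Ω] where
  T : ℕ
  T_pos : 0 < T
  F : ℕ → MeasurableSpace Ω
  F_mono : ∀ ⦃s t : ℕ⦄, s ≤ t → F s ≤ F t
  F_zero : F 0 = ⊥
  F_top : F T = ⊤
  Q : Ω → ℝ
  Q_pos : ∀ ω, 0 < Q ω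
  Q_sum : ∑ ω, Q ω = 1
  Sb : ℕ → Ω → ℝ
  Sa : ℕ → Ω → ℝ
  Sb_pos : ∀ t ω, t ≤ T → 0 < Sb t ω
  Sb_le_Sa : ∀ t ω, t ≤ T → Sb t ω ≤ Sa t ω
  Sb_adapted : ∀ t, t ≤ T → Measurable[F t] (Sb t)
  Sa_adapted : ∀ t, t ≤ T → Measurable[F t] (Sa t)

variable (M : Market Ω)

/-- Liquidation value θ_t(γ, δ) in scenario ω, for a cash position γ and stock position δ. -/
def liq (t : ℕ) (ω : Ω) (γ δ : ℝ) : ℝ :=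
  γ + M.Sb t ω * max δ 0 - M.Sa t ω * max (-δ) 0

/-- An adapted (real-valued) process. -/
def IsAdapted (X : ℕ → Ω → ℝ) : Prop := ∀ t, t ≤ M.T → Measurable[M.F t] (X t)

/-- An adapted ℝ²-valued payoff process. -/
def AdaptedPair (ξ ζ : ℕ → Ω → ℝ) : Prop := IsAdapted M ξ ∧ IsAdapted M ζ

/-- Self-financing strategy. -/
def SelfFinancing (α β : ℕ → Ω → ℝ) : Prop :=
  Measurable[M.F 0] (α 0) ∧ Measurable[M.F 0] (β 0) ∧
  (∀ t, t < M.T → Measurable[M.F t] (α (t + 1)) ∧ Measurable[M.F t] (β (t + 1))) ∧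
  (∀ t, t < M.T → ∀ ω, 0 ≤ liq M t ω (α t ω - α (t + 1) ω) (β t ω - β (t + 1) ω))

/-- Pure stopping time with values in {0,...,T}. -/
def IsStop (τ : Ω → ℕ) : Prop :=
  (∀ ω, τ ω ≤ M.T) ∧ ∀ t : ℕ, MeasurableSet[M.F t] {ω | τ ω = t}

/-- Seller superhedging strategy. -/
def SellerHedge (ξ ζ α β : ℕ → Ω → ℝ) : Prop :=
  SelfFinancing M α β ∧
  ∀ τ, IsStop M τ → ∀ ω,
    0 ≤ liq M (τ ω) ω (α (τ ω) ω - ξ (τ ω) ω) (β (τ ω) ω - ζ (τ ω) ω)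

/-- Buyer superhedging strategy. -/
def BuyerHedge (ξ ζ α β : ℕ → Ω → ℝ) : Prop :=
  SelfFinancing M α β ∧
  ∃ τ, IsStop M τ ∧ ∀ ω,
    0 ≤ liq M (τ ω) ω (α (τ ω) ω + ξ (τ ω) ω) (β (τ ω) ω + ζ (τ ω) ω)

/-- Seller's (ask) price: infimum of the initial costs of seller superhedging strategies. -/
def askPrice (ξ ζ : ℕ → Ω → ℝ) : ℝ :=
  sInf {x | ∃ α β, SellerHedge M ξ ζ α β ∧ ∀ ω, x = -liq M 0 ω (-α 0 ω) (-β 0 ω)}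

/-- Buyer's (bid) price: supremum of the amounts raised by buyer superhedging strategies. -/
def bidPrice (ξ ζ : ℕ → Ω → ℝ) : ℝ :=
  sSup {x | ∃ α β, BuyerHedge M ξ ζ α β ∧ ∀ ω, x = liq M 0 ω (-α 0 ω) (-β 0 ω)}

/-- Mixed stopping time. -/
def IsMixedStop (χ : ℕ → Ω → ℝ) : Prop :=
  (∀ t, t ≤ M.T → Measurable[M.F t] (χ t)) ∧ (∀ t ω, 0 ≤ χ t ω) ∧
  ∀ ω, ∑ t ∈ Finset.range (M.T + 1), χ t ω = 1

/-- χ*_t = Σ_{s=t}^T χ_s  (so χ*_{T+1} = 0). -/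
def chiStar (χ : ℕ → Ω → ℝ) (t : ℕ) (ω : Ω) : ℝ := ∑ s ∈ Finset.Icc t M.T, χ s ω

/-- Z^{χ*}_t = Σ_{s=t}^T χ_s Z_s  (so Z^{χ*}_{T+1} = 0). -/
def starVal (χ Z : ℕ → Ω → ℝ) (t : ℕ) (ω : Ω) : ℝ :=
  ∑ s ∈ Finset.Icc t M.T, χ s ω * Z s ω

/-- Z_χ = Σ_{t=0}^T χ_t Z_t. -/
def mixVal (χ Z : ℕ → Ω → ℝ) (ω : Ω) : ℝ :=
  ∑ t ∈ Finset.range (M.T + 1), χ t ω * Z t ω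

/-- Membership in the family barP(χ). -/
def memBarP (χ : ℕ → Ω → ℝ) (P : Ω → ℝ) (S : ℕ → Ω → ℝ) : Prop :=
  (∀ ω, 0 ≤ P ω) ∧ (∑ ω, P ω) = 1 ∧ IsAdapted M S ∧
  (∀ t ω, t ≤ M.T → M.Sb t ω ≤ S t ω ∧ S t ω ≤ M.Sa t ω) ∧
  (∀ t, t ≤ M.T → ∀ ω, 0 < P ω →
    chiStar M χ (t + 1) ω * M.Sb t ω ≤ condExp (M.F t) P (starVal M χ S (t + 1)) ω ∧
    condExp (M.F t) P (starVal M χ S (t + 1)) ω ≤ chiStar M χ (t + 1) ω * M.Sa t ω)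

/-- Membership in the family P(χ): barP(χ) with P equivalent to Q. -/
def memP (χ : ℕ → Ω → ℝ) (P : Ω → ℝ) (S : ℕ → Ω → ℝ) : Prop :=
  memBarP M χ P S ∧ ∀ ω, 0 < P ω

/-- The mixed stopping time χ^τ associated with a pure stopping time τ. -/
def pureChi (τ : Ω → ℕ) : ℕ → Ω → ℝ := fun t ω => if τ ω = t then 1 else 0

/-- Arbitrage-free: there is an equivalent probability measure and a martingale
between the bid and ask prices. -/
def ArbitrageFree : Prop :=
  ∃ (P : Ω → ℝ) (S : ℕ → Ω → ℝ),
    (∀ ω, 0 < P ω) ∧ (∑ ω, P ω) = 1 ∧ IsAdapted M S ∧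
    (∀ t ω, t ≤ M.T → M.Sb t ω ≤ S t ω ∧ S t ω ≤ M.Sa t ω) ∧
    (∀ t, t < M.T → ∀ ω, 0 < P ω → condExp (M.F t) P (S (t + 1)) ω = S t ω)

/-- Epigraph of a function ℝ → ℝ, as a subset of ℝ² (first coordinate dominates). -/
def epi (f : ℝ → ℝ) : Set (ℝ × ℝ) := {p | f p.2 ≤ p.1}

/-- The function h_{[b,a]}(y) = a y⁻ − b y⁺. -/
def hfun (b a : ℝ) (y : ℝ) : ℝ := a * max (-y) 0 - b * max y 0

/-- Seller's payoff function u_t(y) = ξ_t + (y − ζ_t)⁻ S^a_t − (y − ζ_t)⁺ S^b_t. -/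
def uSell (ξ ζ : ℕ → Ω → ℝ) (t : ℕ) (ω : Ω) (y : ℝ) : ℝ :=
  ξ t ω + M.Sa t ω * max (ζ t ω - y) 0 - M.Sb t ω * max (y - ζ t ω) 0

/-- Buyer's payoff function u_t(y) = −ξ_t + (y + ζ_t)⁻ S^a_t − (y + ζ_t)⁺ S^b_t. -/
def uBuy (ξ ζ : ℕ → Ω → ℝ) (t : ℕ) (ω : Ω) (y : ℝ) : ℝ :=
  -ξ t ω + M.Sa t ω * max (-(y + ζ t ω)) 0 - M.Sb t ω * max (y + ζ t ω) 0

/-- The seller's pricing recursion: one function per atom,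
`z_T = u_T` and `epi z_{t-1} = epi u_{t-1} ∩ (epi h + ⋂_{succ} epi z_t)`. -/
def SellerRec (ξ ζ : ℕ → Ω → ℝ) (z : ℕ → Ω → ℝ → ℝ) : Prop :=
  (∀ t ω ω', t ≤ M.T → sameAtom (M.F t) ω ω' → z t ω = z t ω') ∧
  (∀ ω, z M.T ω = uSell M ξ ζ M.T ω) ∧
  (∀ t ω, t < M.T →
    epi (z t ω) = epi (uSell M ξ ζ t ω) ∩
      (epi (hfun (M.Sb t ω) (M.Sa t ω)) +
        ⋂ ω' ∈ {ω'' | sameAtom (M.F t) ω ω''}, epi (z (t + 1) ω')))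

/-- The buyer's pricing recursion: one function per atom,
`z_T = u_T` and `epi z_{t-1} = epi u_{t-1} ∪ (epi h + ⋂_{succ} epi z_t)`. -/
def BuyerRec (ξ ζ : ℕ → Ω → ℝ) (z : ℕ → Ω → ℝ → ℝ) : Prop :=
  (∀ t ω ω', t ≤ M.T → sameAtom (M.F t) ω ω' → z t ω = z t ω') ∧
  (∀ ω, z M.T ω = uBuy M ξ ζ M.T ω) ∧
  (∀ t ω, t < M.T →
    epi (z t ω) = epi (uBuy M ξ ζ t ω) ∪
      (epi (hfun (M.Sb t ω) (M.Sa t ω)) +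
        ⋂ ω' ∈ {ω'' | sameAtom (M.F t) ω ω''}, epi (z (t + 1) ω')))

/-- A linear program (finitely many affine inequalities on an affine subspace, of arbitrary
dimension) that is feasible and bounded has an optimal solution. -/
theorem exists_isMaxOn_of_affine_constraints {V ι : Type*} [AddCommGroup V] [Module ℝ V]
    (g : V →ᵃ[ℝ] ℝ) (f : ι → V →ᵃ[ℝ] ℝ) (s : Finset ι) (A : AffineSubspace ℝ V)
    (hne : {v | v ∈ A ∧ ∀ i ∈ s, 0 ≤ f i v}.Nonempty)
    (hb : BddAbove (g '' {v | v ∈ A ∧ ∀ i ∈ s, 0 ≤ f i v})) :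
    ∃ v ∈ {v | v ∈ A ∧ ∀ i ∈ s, 0 ≤ f i v},
      IsMaxOn g {v | v ∈ A ∧ ∀ i ∈ s, 0 ≤ f i v} v := by
  classical
  induction s using Finset.induction_on generalizing A with
  | empty =>
    obtain ⟨v, hv⟩ := hne
    refine ⟨v, hv, fun w hw => ?_⟩
    obtain ⟨K, hK⟩ := hb
    by_contra hlt
    have hlt : g v < g w := not_le.mp hlt
    have hmem : AffineMap.lineMap v w ((K - g v + 1) / (g w - g v)) ∈ A :=
      AffineMap.lineMap_mem _ hv.1 hw.1
    have h := hK ⟨_, ⟨hmem, by simp⟩, rfl⟩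
    rw [AffineMap.apply_lineMap, AffineMap.lineMap_apply_ring'] at h
    rw [div_mul_cancel₀ _ (sub_pos.mpr hlt).ne'] at h
    linarith
  | insert j s _ ih =>
    by_cases hout : ∃ v, (v ∈ A ∧ ∀ i ∈ s, 0 ≤ f i v) ∧ f j v < 0 ∧
        ∀ p, (p ∈ A ∧ ∀ i ∈ insert j s, 0 ≤ f i p) → g p ≤ g v
    · obtain ⟨v, ⟨hvA, hvs⟩, hvj, hvg⟩ := hout
      let B : AffineSubspace ℝ V := A ⊓ (AffineSubspace.mk' (0 : ℝ) ⊥).comap (f j)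
      have hB : ∀ p, p ∈ B ↔ p ∈ A ∧ f j p = 0 := by
        intro p
        simp [B, AffineSubspace.mem_inf_iff, AffineSubspace.mem_comap, AffineSubspace.mem_mk']
      have hface : ∀ p, (p ∈ A ∧ ∀ i ∈ insert j s, 0 ≤ f i p) →
          ∃ q, (q ∈ B ∧ ∀ i ∈ s, 0 ≤ f i q) ∧ g p ≤ g q := by
        rintro p ⟨hpA, hps⟩
        have hpj := hps j (Finset.mem_insert_self _ _)
        have hd : 0 < f j p - f j v := by linarith
        set t := f j p / (f j p - f j v) with ht
        have ht0 : 0 ≤ t := div_nonneg hpj hd.le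
        have ht1 : t ≤ 1 := (div_le_one hd).mpr (by linarith)
        have hval : ∀ φ : V →ᵃ[ℝ] ℝ, φ (AffineMap.lineMap p v t) = t * (φ v - φ p) + φ p :=
          fun φ => by rw [AffineMap.apply_lineMap, AffineMap.lineMap_apply_ring']
        refine ⟨AffineMap.lineMap p v t, ⟨(hB _).mpr ⟨AffineMap.lineMap_mem _ hpA hvA, ?_⟩,
          fun i hi => ?_⟩, ?_⟩
        · rw [hval, ht]
          field_simp
          ring
        · rw [hval]
          nlinarith [hvs i hi, hps i (Finset.mem_insert_of_mem hi)]
        · rw [hval]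
          nlinarith [hvg p ⟨hpA, hps⟩]
      have hsub : ∀ q, (q ∈ B ∧ ∀ i ∈ s, 0 ≤ f i q) →
          q ∈ A ∧ ∀ i ∈ insert j s, 0 ≤ f i q := by
        rintro q ⟨hqB, hqs⟩
        obtain ⟨hqA, hqj⟩ := (hB q).mp hqB
        exact ⟨hqA, Finset.forall_mem_insert _ _ _ |>.mpr ⟨hqj.ge, hqs⟩⟩
      obtain ⟨p, hp⟩ := hne
      obtain ⟨q, hq, -⟩ := hface p hp
      obtain ⟨m, hm, hmax⟩ := ih B ⟨q, hq⟩ (hb.mono (Set.image_mono hsub))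
      refine ⟨m, hsub m hm, fun w hw => ?_⟩
      obtain ⟨r, hr, hwr⟩ := hface w hw
      exact hwr.trans (hmax hr)
    · push Not at hout
      obtain ⟨K, hK⟩ := hb
      obtain ⟨p, hp⟩ := hne
      have hbound : ∀ v, (v ∈ A ∧ ∀ i ∈ s, 0 ≤ f i v) → g v ≤ K := by
        intro v hv
        rcases lt_or_ge (f j v) 0 with hj | hj
        · obtain ⟨q, hq, hlt⟩ := hout v hv hj
          exact hlt.le.trans (hK ⟨q, hq, rfl⟩)
        · exact hK ⟨v, ⟨hv.1, Finset.forall_mem_insert _ _ _ |>.mpr ⟨hj, hv.2⟩⟩, rfl⟩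
      have hrelax : ∀ q, (q ∈ A ∧ ∀ i ∈ insert j s, 0 ≤ f i q) →
          q ∈ A ∧ ∀ i ∈ s, 0 ≤ f i q :=
        fun q hq => ⟨hq.1, fun i hi => hq.2 i (Finset.mem_insert_of_mem hi)⟩
      obtain ⟨m, hm, hmax⟩ := ih A ⟨p, hrelax p hp⟩
        ⟨K, by rintro _ ⟨v, hv, rfl⟩; exact hbound v hv⟩
      have hmj : 0 ≤ f j m := by
        by_contra hj
        obtain ⟨q, hq, hlt⟩ := hout m hm (not_le.mp hj)
        exact absurd (hmax (hrelax q hq)) (not_le.mpr hlt)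
      exact ⟨m, ⟨hm.1, Finset.forall_mem_insert _ _ _ |>.mpr ⟨hmj, hm.2⟩⟩,
        fun w hw => hmax (hrelax w hw)⟩

theorem eq_of_sameAtom {X : Type*} {m : MeasurableSpace X} {f : X → ℝ} (hf : Measurable[m] f)
    {ω ω' : X} (h : sameAtom m ω ω') : f ω' = f ω :=
  (h (f ⁻¹' {f ω}) (hf (measurableSet_singleton _))).mp rfl

/-- Somewhere on the atom of `ω`, the multiple `b * f` is at most its conditional mean. -/
theorem exists_sameAtom_mul_le_mul_condExp (m : MeasurableSpace Ω) {P : Ω → ℝ}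
    (hP : ∀ ω, 0 < P ω) (f : Ω → ℝ) (b : ℝ) (ω : Ω) :
    ∃ ω', sameAtom m ω ω' ∧ b * f ω' ≤ b * condExp m P f ω := by
  classical
  have hmem : sameAtom m ω ω := fun _ _ => Iff.rfl
  by_contra! hlt
  set D := ∑ ω' : Ω, Set.indicator {ω'' | sameAtom m ω ω''} P ω' with hD
  have hDpos : 0 < D :=
    Finset.sum_pos' (fun ω' _ => Set.indicator_nonneg (fun a _ => (hP a).le) ω')
      ⟨ω, Finset.mem_univ _, by simpa [Set.indicator, hmem] using hP ω⟩
  have hmean : D * condExp m P f ω =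
      ∑ ω' : Ω, Set.indicator {ω'' | sameAtom m ω ω''} (fun ω'' => P ω'' * f ω'') ω' := by
    rw [condExp, ← hD, mul_div_cancel₀ _ hDpos.ne']
  have hsum : D * (b * condExp m P f ω) <
      b * ∑ ω' : Ω, Set.indicator {ω'' | sameAtom m ω ω''} (fun ω'' => P ω'' * f ω'') ω' := by
    rw [hD, Finset.sum_mul, Finset.mul_sum]
    refine Finset.sum_lt_sum (fun ω' _ => ?_) ⟨ω, Finset.mem_univ _, ?_⟩
    · by_cases h : sameAtom m ω ω'
      · simp only [Set.indicator, Set.mem_ofPred_eq, h, if_true]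
        nlinarith [hlt ω' h, hP ω']
      · simp [Set.indicator, h]
    · simp only [Set.indicator, Set.mem_ofPred_eq, hmem, if_true]
      nlinarith [hlt ω hmem, hP ω]
  rw [← hmean] at hsum
  linarith [mul_left_comm D b (condExp m P f ω)]

variable {M}

theorem liq_nonneg_iff {t : ℕ} (ht : t ≤ M.T) (ω : Ω) (γ δ : ℝ) :
    0 ≤ liq M t ω γ δ ↔ 0 ≤ γ + M.Sb t ω * δ ∧ 0 ≤ γ + M.Sa t ω * δ := by
  have hle := M.Sb_le_Sa t ω ht
  unfold liq
  rcases le_total 0 δ with h | h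
  · rw [max_eq_left h, max_eq_right (neg_nonpos.mpr h)]
    constructor
    · intro h0
      constructor <;> nlinarith
    · rintro ⟨h0, -⟩
      linarith
  · rw [max_eq_right h, max_eq_left (neg_nonneg.mpr h)]
    constructor
    · intro h0
      constructor <;> nlinarith
    · rintro ⟨-, h0⟩
      linarith

theorem add_mul_nonneg_of_liq_nonneg {t : ℕ} (ht : t ≤ M.T) {ω : Ω} {γ δ s : ℝ}
    (hs : M.Sb t ω ≤ s ∧ s ≤ M.Sa t ω) (h : 0 ≤ liq M t ω γ δ) : 0 ≤ γ + s * δ := by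
  obtain ⟨hb, ha⟩ := (liq_nonneg_iff ht ω γ δ).mp h
  rcases le_total 0 δ with hδ | hδ <;> nlinarith

theorem liq_add_nonneg {t : ℕ} (ht : t ≤ M.T) {ω : Ω} {γ δ γ' δ' : ℝ}
    (h : 0 ≤ liq M t ω γ δ) (h' : 0 ≤ liq M t ω γ' δ') :
    0 ≤ liq M t ω (γ + γ') (δ + δ') := by
  rw [liq_nonneg_iff ht] at *
  constructor <;> linarith [h.1, h.2, h'.1, h'.2]

theorem liq_add_cash (t : ℕ) (ω : Ω) (c γ δ : ℝ) :
    liq M t ω (c + γ) δ = c + liq M t ω γ δ := by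
  unfold liq
  ring

theorem liq_cash (t : ℕ) (ω : Ω) (γ : ℝ) : liq M t ω γ 0 = γ := by
  simp [liq]

/-- The strategy `(α, β)` with initial endowment `(-x, 0)` superhedges the buyer's position
when the option is exercised at `τ`. -/
structure CashHedge (M : Market Ω) (ξ ζ : ℕ → Ω → ℝ) (τ : Ω → ℕ) (x : ℝ) (α β : ℕ → Ω → ℝ) :
    Prop where
  selfFinancing : SelfFinancing M α β
  cash : ∀ ω, α 0 ω = -x
  stock : ∀ ω, β 0 ω = 0
  hedge : ∀ ω, 0 ≤ liq M (τ ω) ω (α (τ ω) ω + ξ (τ ω) ω) (β (τ ω) ω + ζ (τ ω) ω)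

theorem exists_cashHedge {ξ ζ α β : ℕ → Ω → ℝ} {τ : Ω → ℕ} {x : ℝ}
    (hsf : SelfFinancing M α β)
    (hh : ∀ ω, 0 ≤ liq M (τ ω) ω (α (τ ω) ω + ξ (τ ω) ω) (β (τ ω) ω + ζ (τ ω) ω))
    (hx : ∀ ω, x = liq M 0 ω (-α 0 ω) (-β 0 ω)) :
    ∃ α' β', CashHedge M ξ ζ τ x α' β' := by
  have hinit : ∀ ω, 0 ≤ liq M 0 ω (-x - α 0 ω) (0 - β 0 ω) := by
    intro ω
    rw [sub_eq_add_neg, liq_add_cash, zero_sub, ← hx ω]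
    simp
  obtain ⟨-, -, hmeas, hself⟩ := hsf
  let α' : ℕ → Ω → ℝ := fun t ω => if t = 0 then -x else α t ω
  let β' : ℕ → Ω → ℝ := fun t ω => if t = 0 then 0 else β t ω
  refine ⟨α', β', ⟨⟨?_, ?_, ?_, ?_⟩, fun ω => by simp [α'], fun ω => by simp [β'], ?_⟩⟩
  · simp [α']
  · simp [β']
  · intro t ht
    simpa [α', β'] using hmeas t ht
  · intro t ht ω
    rcases Nat.eq_zero_or_pos t with rfl | hpos
    · convert liq_add_nonneg (Nat.zero_le _) (hinit ω) (hself 0 ht ω) using 1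
      congr 1 <;> simp [α', β'] <;> ring
    · simpa [α', β', hpos.ne'] using hself t ht ω
  · intro ω
    have hω := hh ω
    rcases Nat.eq_zero_or_pos (τ ω) with h0 | hpos
    · rw [h0] at hω ⊢
      convert liq_add_nonneg (Nat.zero_le _) (hinit ω) hω using 1
      congr 1 <;> simp [α', β'] <;> ring
    · simpa [α', β', hpos.ne'] using hω

theorem IsStop.measurableSet_le {τ : Ω → ℕ} (hτ : IsStop M τ) (t : ℕ) :
    MeasurableSet[M.F t] {ω | τ ω ≤ t} := by
  have : {ω | τ ω ≤ t} = ⋃ s ∈ Set.Iic t, {ω | τ ω = s} := by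
    ext ω
    simp
  rw [this]
  exact MeasurableSet.biUnion (Set.to_countable _) fun s hs => M.F_mono hs _ (hτ.2 s)

/-- Under a martingale between the bid and ask prices, the stopped wealth of a self-financing
strategy cannot exceed the initial endowment in every scenario. -/
theorem exists_stopped_wealth_le {P : Ω → ℝ} {S : ℕ → Ω → ℝ} (hP : ∀ ω, 0 < P ω)
    (hS : ∀ t ω, t ≤ M.T → M.Sb t ω ≤ S t ω ∧ S t ω ≤ M.Sa t ω)
    (hmart : ∀ t, t < M.T → ∀ ω, condExp (M.F t) P (S (t + 1)) ω = S t ω)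
    {α β : ℕ → Ω → ℝ} (hsf : SelfFinancing M α β) {τ : Ω → ℕ} (hτ : IsStop M τ) (ω₀ : Ω)
    {t : ℕ} (ht : t ≤ M.T) :
    ∃ ω, α (min (τ ω) t) ω + S (min (τ ω) t) ω * β (min (τ ω) t) ω ≤
      α 0 ω₀ + S 0 ω₀ * β 0 ω₀ := by
  induction t with
  | zero => exact ⟨ω₀, by simp⟩
  | succ t ih =>
    obtain ⟨ω, hω⟩ := ih (by omega)
    rcases le_or_gt (τ ω) t with hle_t | hrun
    · refine ⟨ω, ?_⟩
      rwa [min_eq_left (by omega : τ ω ≤ t + 1), ← min_eq_left hle_t]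
    · obtain ⟨ω', hatom, hle⟩ :=
        exists_sameAtom_mul_le_mul_condExp (M.F t) hP (S (t + 1)) (β (t + 1) ω) ω
      have hrun' : t < τ ω' := by
        by_contra hle_t
        exact absurd ((hatom _ (hτ.measurableSet_le t)).mpr (not_lt.mp hle_t)) (not_le.mpr hrun)
      have hα := eq_of_sameAtom (hsf.2.2.1 t ht).1 hatom
      have hβ := eq_of_sameAtom (hsf.2.2.1 t ht).2 hatom
      have hself := add_mul_nonneg_of_liq_nonneg (by omega) (hS t ω (by omega))
        (hsf.2.2.2 t ht ω)
      rw [hmart t ht] at hle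
      rw [min_eq_right hrun.le] at hω
      refine ⟨ω', ?_⟩
      rw [min_eq_right (Nat.succ_le_of_lt hrun'), hα, hβ]
      linarith

theorem exists_cashHedge_le (hNA : ArbitrageFree M) (ξ ζ : ℕ → Ω → ℝ) :
    ∃ K, ∀ τ x α β, IsStop M τ → CashHedge M ξ ζ τ x α β → x ≤ K := by
  obtain ⟨P, S, hP, hP1, -, hS, hmart⟩ := hNA
  have hne : Nonempty Ω := by
    by_contra h
    rw [not_nonempty_iff] at h
    simp at hP1
  obtain ⟨ω₀⟩ := hne
  obtain ⟨K, hK⟩ := (Set.finite_range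
    fun p : Fin (M.T + 1) × Ω => ξ p.1 p.2 + S p.1 p.2 * ζ p.1 p.2).bddAbove
  refine ⟨K, fun τ x α β hτ h => ?_⟩
  obtain ⟨ω, hω⟩ := exists_stopped_wealth_le hP hS (fun t ht ω => hmart t ht ω (hP ω))
    h.selfFinancing hτ ω₀ le_rfl
  rw [min_eq_left (hτ.1 ω), h.cash, h.stock] at hω
  have hhedge := add_mul_nonneg_of_liq_nonneg (hτ.1 ω) (hS _ ω (hτ.1 ω)) (h.hedge ω)
  have := hK ⟨(⟨τ ω, Nat.lt_succ_of_le (hτ.1 ω)⟩, ω), rfl⟩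
  dsimp only at this
  linarith

variable (M) in
/-- Predictable processes `(α, β)` starting from a constant cash position and no stock. -/
def cashStart : AffineSubspace ℝ ((ℕ → Ω → ℝ) × (ℕ → Ω → ℝ)) where
  carrier := {p | (∃ c, ∀ ω, p.1 0 ω = c) ∧ (∀ ω, p.2 0 ω = 0) ∧
    ∀ t, t < M.T → Measurable[M.F t] (p.1 (t + 1)) ∧ Measurable[M.F t] (p.2 (t + 1))}
  smul_vsub_vadd_mem' := by
    rintro r p q s ⟨⟨a, ha⟩, ha', hp⟩ ⟨⟨b, hb⟩, hb', hq⟩ ⟨⟨c, hc⟩, hc', hs⟩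
    refine ⟨⟨r * (a - b) + c, fun ω => by simp [ha, hb, hc]⟩,
      fun ω => by simp [ha', hb', hc'], fun t ht => ⟨?_, ?_⟩⟩
    · exact (((hp t ht).1.sub (hq t ht).1).const_smul r).add (hs t ht).1
    · exact (((hp t ht).2.sub (hq t ht).2).const_smul r).add (hs t ht).2

theorem exists_greatest_cashHedge {ξ ζ : ℕ → Ω → ℝ} {τ : Ω → ℕ} (hτ : IsStop M τ) {K : ℝ}
    (hK : ∀ x α β, CashHedge M ξ ζ τ x α β → x ≤ K) (hne : ∃ x α β, CashHedge M ξ ζ τ x α β)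
    (ω₀ : Ω) :
    ∃ x, IsGreatest {x | ∃ α β, CashHedge M ξ ζ τ x α β} x := by
  let ev (t : ℕ) (ω : Ω) : (ℕ → Ω → ℝ) →ₗ[ℝ] ℝ := LinearMap.proj ω ∘ₗ LinearMap.proj t
  let evα (t : ℕ) (ω : Ω) : (ℕ → Ω → ℝ) × (ℕ → Ω → ℝ) →ₗ[ℝ] ℝ :=
    ev t ω ∘ₗ LinearMap.fst ℝ _ _
  let evβ (t : ℕ) (ω : Ω) : (ℕ → Ω → ℝ) × (ℕ → Ω → ℝ) →ₗ[ℝ] ℝ :=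
    ev t ω ∘ₗ LinearMap.snd ℝ _ _
  let price (k : Bool) : ℕ → Ω → ℝ := if k then M.Sb else M.Sa
  let trade (i : Bool × Fin M.T × Ω) : (ℕ → Ω → ℝ) × (ℕ → Ω → ℝ) →ᵃ[ℝ] ℝ :=
    (evα i.2.1 i.2.2 - evα (i.2.1 + 1) i.2.2 +
      price i.1 i.2.1 i.2.2 • (evβ i.2.1 i.2.2 - evβ (i.2.1 + 1) i.2.2)).toAffineMap
  let exercise (i : Bool × Ω) : (ℕ → Ω → ℝ) × (ℕ → Ω → ℝ) →ᵃ[ℝ] ℝ :=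
    (evα (τ i.2) i.2 + price i.1 (τ i.2) i.2 • evβ (τ i.2) i.2).toAffineMap +
      AffineMap.const ℝ _ (ξ (τ i.2) i.2 + price i.1 (τ i.2) i.2 * ζ (τ i.2) i.2)
  let f := Sum.elim trade exercise
  have hiff : ∀ α β : ℕ → Ω → ℝ,
      ((α, β) ∈ cashStart M ∧ ∀ i ∈ Finset.univ, 0 ≤ f i (α, β)) ↔
        CashHedge M ξ ζ τ (-α 0 ω₀) α β := by
    intro α β
    have htrade : ∀ t (ht : t < M.T) ω,
        0 ≤ liq M t ω (α t ω - α (t + 1) ω) (β t ω - β (t + 1) ω) ↔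
          ∀ k, 0 ≤ trade (k, ⟨t, ht⟩, ω) (α, β) := by
      intro t ht ω
      rw [liq_nonneg_iff ht.le, Bool.forall_bool, and_comm]
      simp [trade, evα, evβ, ev, price]
    have hexercise : ∀ ω,
        0 ≤ liq M (τ ω) ω (α (τ ω) ω + ξ (τ ω) ω) (β (τ ω) ω + ζ (τ ω) ω) ↔
          ∀ k, 0 ≤ exercise (k, ω) (α, β) := by
      intro ω
      rw [liq_nonneg_iff (hτ.1 ω), Bool.forall_bool, and_comm]
      simp [exercise, evα, evβ, ev, price, mul_add, add_add_add_comm]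
    constructor
    · rintro ⟨⟨⟨c, hc⟩, h0, hmeas⟩, hf⟩
      have hc' : α 0 = fun _ => c := funext hc
      have h0' : β 0 = fun _ => 0 := funext h0
      refine ⟨⟨?_, ?_, hmeas, fun t ht ω => (htrade t ht ω).mpr fun k =>
        hf (Sum.inl (k, ⟨t, ht⟩, ω)) (Finset.mem_univ _)⟩, fun ω => ?_, h0, fun ω =>
        (hexercise ω).mpr fun k => hf (Sum.inr (k, ω)) (Finset.mem_univ _)⟩
      · rw [hc']
        exact measurable_const
      · rw [h0']
        exact measurable_const
      · simp [hc']
    · intro h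
      refine ⟨⟨⟨_, h.cash⟩, h.stock, h.selfFinancing.2.2.1⟩, ?_⟩
      rintro (⟨k, t, ω⟩ | ⟨k, ω⟩) -
      · exact (htrade t t.2 ω).mp (h.selfFinancing.2.2.2 t t.2 ω) k
      · exact (hexercise ω).mp (h.hedge ω) k
  have hx : ∀ {x α β}, CashHedge M ξ ζ τ x α β → -α 0 ω₀ = x := fun h => by simp [h.cash]
  obtain ⟨x, α, β, h⟩ := hne
  obtain ⟨⟨α', β'⟩, hm, hmax⟩ := exists_isMaxOn_of_affine_constraints
    (-evα 0 ω₀).toAffineMap f Finset.univ (cashStart M)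
    ⟨(α, β), (hiff α β).mpr (by rwa [hx h])⟩
    ⟨K, by
      rintro _ ⟨⟨α, β⟩, hp, rfl⟩
      exact hK _ _ _ ((hiff α β).mp hp)⟩
  refine ⟨-α' 0 ω₀, ⟨α', β', (hiff α' β').mp hm⟩, ?_⟩
  rintro y ⟨α, β, hy⟩
  have := hmax ((hiff α β).mpr (by rwa [hx hy]))
  rw [← hx hy]
  exact this

theorem exists_cashHedge_zero (ξ ζ : ℕ → Ω → ℝ) :
    ∃ x α β, CashHedge M ξ ζ (fun _ => 0) x α β := by
  obtain ⟨x, hx⟩ := (Set.finite_range fun ω => liq M 0 ω (ξ 0 ω) (ζ 0 ω)).bddBelow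
  refine ⟨x, fun _ _ => -x, fun _ _ => 0, ⟨⟨measurable_const, measurable_const,
    fun _ _ => ⟨measurable_const, measurable_const⟩, fun t _ ω => by simp [liq]⟩,
    fun _ => rfl, fun _ => rfl, fun ω => ?_⟩⟩
  rw [liq_add_cash, zero_add]
  linarith [hx ⟨ω, rfl⟩]

variable (M) in
theorem isStop_zero : IsStop M fun _ => 0 :=
  ⟨fun _ => Nat.zero_le _, fun _ => MeasurableSet.const _⟩

variable (M) in
theorem finite_isStop : {τ | IsStop M τ}.Finite :=
  (Set.Finite.pi' fun _ : Ω => Set.finite_Iic M.T).subset fun _ hτ => hτ.1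

theorem exists_greatest_cashHedge_isStop (hNA : ArbitrageFree M) (ξ ζ : ℕ → Ω → ℝ) :
    ∃ x, IsGreatest {x | ∃ τ, IsStop M τ ∧ ∃ α β, CashHedge M ξ ζ τ x α β} x := by
  have hne : Nonempty Ω := by
    by_contra h
    rw [not_nonempty_iff] at h
    simpa using M.Q_sum
  obtain ⟨ω₀⟩ := hne
  obtain ⟨K, hK⟩ := exists_cashHedge_le hNA ξ ζ
  have hgreatest : ∀ τ ∈ {τ | IsStop M τ ∧ ∃ x α β, CashHedge M ξ ζ τ x α β},
      ∃ x, IsGreatest {x | ∃ α β, CashHedge M ξ ζ τ x α β} x := fun τ hτ =>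
    exists_greatest_cashHedge hτ.1 (fun x α β => hK τ x α β hτ.1) hτ.2 ω₀
  choose! v hv using hgreatest
  obtain ⟨τ, hτ, hmax⟩ := Set.exists_max_image
    {τ | IsStop M τ ∧ ∃ x α β, CashHedge M ξ ζ τ x α β} v
    ((finite_isStop M).subset fun _ h => h.1)
    ⟨fun _ => 0, isStop_zero M, exists_cashHedge_zero ξ ζ⟩
  refine ⟨v τ, ⟨τ, hτ.1, (hv τ hτ).1⟩, ?_⟩
  rintro x ⟨σ, hσ, α, β, h⟩
  have hσ' : IsStop M σ ∧ ∃ x α β, CashHedge M ξ ζ σ x α β := ⟨hσ, x, α, β, h⟩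
  exact ((hv σ hσ').2 ⟨α, β, h⟩).trans (hmax σ hσ')

variable (M)

/-- Corollary: there are a self-financing strategy starting from (−π^b(ξ,ζ), 0) and a
pure stopping time realising the buyer's superhedging condition; they attain the
supremum defining the buyer's price. -/
theorem buyer_optimal_strategy (ξ ζ : ℕ → Ω → ℝ)
    (hpay : AdaptedPair M ξ ζ) (hNA : ArbitrageFree M) :
    ∃ α β τ, SelfFinancing M α β ∧ IsStop M τ ∧
      (∀ ω, α 0 ω = -bidPrice M ξ ζ ∧ β 0 ω = 0) ∧
      (∀ ω, 0 ≤ liq M (τ ω) ω (α (τ ω) ω + ξ (τ ω) ω) (β (τ ω) ω + ζ (τ ω) ω)) ∧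
      ∀ ω, liq M 0 ω (-α 0 ω) (-β 0 ω) = bidPrice M ξ ζ := by
  obtain ⟨x, ⟨τ, hτ, α, β, h⟩, hmax⟩ := exists_greatest_cashHedge_isStop hNA ξ ζ
  have hval : ∀ ω, liq M 0 ω (-α 0 ω) (-β 0 ω) = x := fun ω => by
    rw [h.cash, h.stock, neg_zero, liq_cash, neg_neg]
  have hprice : bidPrice M ξ ζ = x := by
    refine IsGreatest.csSup_eq ⟨⟨α, β, ⟨h.selfFinancing, τ, hτ, h.hedge⟩, fun ω => (hval ω).symm⟩,
      ?_⟩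
    rintro y ⟨α', β', ⟨hsf, σ, hσ, hh⟩, hy⟩
    exact hmax ⟨σ, hσ, exists_cashHedge hsf hh hy⟩
  rw [hprice]
  exact ⟨α, β, τ, h.selfFinancing, hτ, fun ω => ⟨h.cash ω, h.stock ω⟩, h.hedge, hval⟩

end RZ
end
end

section
/- Let (z_t) be functions produced by the buyer's pricing recursion for an American option with adapted ℝ²-valued payoff (ξ,ζ) in an arbitrage-free model. Then there exist a pure stopping time τ̌ and a pair (P̌,Š) ∈ barP(τ̌) such that E_{P̌}(ξ_τ̌ + Š_τ̌ ζ_τ̌) = min_{(P,S) ∈ barP(τ̌)} E_P(ξ_τ̌ + S_τ̌ ζ_τ̌) ≥ −z_0(0). -/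
open MeasureTheory
open scoped Pointwise

noncomputable section

namespace RZ

variable {Ω : Type*} [Fintype Ω]

variable (M : Market Ω)

theorem sameAtom_refl {α : Type*} (m : MeasurableSpace α) (ω : α) : sameAtom m ω ω :=
  fun _ _ => Iff.rfl

theorem sameAtom.symm {α : Type*} {m : MeasurableSpace α} {ω ω' : α} (h : sameAtom m ω ω') :
    sameAtom m ω' ω := fun A hA => (h A hA).symm

theorem sameAtom.trans {α : Type*} {m : MeasurableSpace α} {ω ω' ω'' : α} (h : sameAtom m ω ω')
    (h' : sameAtom m ω' ω'') : sameAtom m ω ω'' := fun A hA => (h A hA).trans (h' A hA)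

theorem sameAtom.mono {α : Type*} {m m' : MeasurableSpace α} (hm : m ≤ m') {ω ω' : α}
    (h : sameAtom m' ω ω') : sameAtom m ω ω' := fun A hA => h A (hm A hA)

theorem sameAtom.setOf_eq {α : Type*} {m : MeasurableSpace α} {ω ω' : α} (h : sameAtom m ω ω') :
    {ω'' | sameAtom m ω ω''} = {ω'' | sameAtom m ω' ω''} :=
  Set.ext fun _ => ⟨fun h' => h.symm.trans h', fun h' => h.trans h'⟩

theorem measurableSet_setOf_sameAtom (m : MeasurableSpace Ω) (ω : Ω) :
    MeasurableSet[m] {ω' | sameAtom m ω ω'} := by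
  have h : {ω' | sameAtom m ω ω'} = ⋂ A ∈ {A : Set Ω | MeasurableSet[m] A ∧ ω ∈ A}, A := by
    ext ω'
    simp only [Set.mem_ofPred_eq, Set.mem_iInter]
    refine ⟨fun h A hA => (h A hA.1).1 hA.2, fun h A hA => ⟨fun hω => h A ⟨hA, hω⟩, fun hω' => ?_⟩⟩
    by_contra hω
    exact h Aᶜ ⟨hA.compl, hω⟩ hω'
  rw [h]
  exact MeasurableSet.biInter (Set.toFinite _).countable fun A hA => hA.1

theorem measurableSet_of_sameAtom {m : MeasurableSpace Ω} {s : Set Ω}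
    (h : ∀ ω ω', sameAtom m ω ω' → ω ∈ s → ω' ∈ s) : MeasurableSet[m] s := by
  have hs : s = ⋃ ω ∈ s, {ω' | sameAtom m ω ω'} := by
    ext ω'
    simp only [Set.mem_iUnion, Set.mem_ofPred_eq, exists_prop]
    exact ⟨fun hω' => ⟨ω', hω', sameAtom_refl m ω'⟩, fun ⟨ω, hω, hωω'⟩ => h ω ω' hωω' hω⟩
  rw [hs]
  exact MeasurableSet.biUnion (Set.toFinite _).countable
    fun ω _ => measurableSet_setOf_sameAtom m ω

theorem measurable_iff_sameAtom {m : MeasurableSpace Ω} {f : Ω → ℝ} :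
    Measurable[m] f ↔ ∀ ω ω', sameAtom m ω ω' → f ω = f ω' := by
  refine ⟨fun hf ω ω' h => ?_, fun hf s _ => measurableSet_of_sameAtom fun ω ω' h hω => ?_⟩
  · exact ((h _ (hf (measurableSet_singleton (f ω)))).1 rfl).symm
  · rw [Set.mem_preimage] at hω ⊢
    rwa [← hf ω ω' h]

open Classical in
/-- The atom of `m` containing `ω`, as a finite set. -/
def atom (m : MeasurableSpace Ω) (ω : Ω) : Finset Ω := {ω' | sameAtom m ω ω'}

theorem mem_atom {m : MeasurableSpace Ω} {ω ω' : Ω} : ω' ∈ atom m ω ↔ sameAtom m ω ω' := by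
  simp [atom]

theorem sameAtom.atom_eq {m : MeasurableSpace Ω} {ω ω' : Ω} (h : sameAtom m ω ω') :
    atom m ω = atom m ω' := by
  ext ω''
  rw [mem_atom, mem_atom]
  exact ⟨fun h' => h.symm.trans h', fun h' => h.trans h'⟩

theorem condExp_eq (m : MeasurableSpace Ω) (P f : Ω → ℝ) (ω : Ω) :
    condExp m P f ω = (∑ ω' ∈ atom m ω, P ω' * f ω') / ∑ ω' ∈ atom m ω, P ω' := by
  classical
  simp [condExp, atom, Finset.sum_filter, Set.indicator_apply]

theorem sum_nonneg_of_sum_atom_nonneg (m : MeasurableSpace Ω) {g : Ω → ℝ}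
    (hg : ∀ ω, 0 ≤ ∑ ω' ∈ atom m ω, g ω') : 0 ≤ ∑ ω, g ω := by
  classical
  let R : Setoid Ω := ⟨sameAtom m, sameAtom_refl m, sameAtom.symm, sameAtom.trans⟩
  rw [Finset.sum_partition R]
  refine Finset.sum_nonneg fun q hq => ?_
  obtain ⟨ω, -, rfl⟩ := Finset.mem_image.1 hq
  refine (hg ω).trans_eq (Finset.sum_congr ?_ fun _ _ => rfl)
  ext ω'
  rw [mem_atom, Finset.mem_filter]
  simp only [Finset.mem_univ, true_and]
  exact Iff.symm (Quotient.eq.trans ⟨sameAtom.symm, sameAtom.symm⟩)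

theorem sum_eq_zero_of_sum_atom_eq_zero (m : MeasurableSpace Ω) {g : Ω → ℝ}
    (hg : ∀ ω, ∑ ω' ∈ atom m ω, g ω' = 0) : ∑ ω, g ω = 0 := by
  have h₁ := sum_nonneg_of_sum_atom_nonneg m fun ω => (hg ω).ge
  have h₂ := sum_nonneg_of_sum_atom_nonneg m (g := fun ω => -g ω) fun ω => by
    simp [Finset.sum_neg_distrib, hg ω]
  rw [Finset.sum_neg_distrib] at h₂
  linarith

variable {M} in
theorem IsStop.lt_iff_of_sameAtom {τ : Ω → ℕ} (hτ : IsStop M τ) {t : ℕ} {ω ω' : Ω}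
    (h : sameAtom (M.F t) ω ω') : t < τ ω ↔ t < τ ω' := by
  have key : ∀ ω ω', sameAtom (M.F t) ω ω' → τ ω ≤ t → τ ω' ≤ t := fun ω ω' h hω => by
    have : τ ω' = τ ω := (h {ω'' | τ ω'' = τ ω} (M.F_mono hω _ (hτ.2 (τ ω)))).1 rfl
    exact this.trans_le hω
  rw [← not_le, ← not_le, not_iff_not]
  exact ⟨key ω ω' h, key ω' ω h.symm⟩

variable {M} in
theorem IsStop.chiStar_pureChi {τ : Ω → ℕ} (hτ : IsStop M τ) (t : ℕ) (ω : Ω) :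
    chiStar M (pureChi τ) (t + 1) ω = if t < τ ω then 1 else 0 := by
  have := hτ.1 ω
  simp [chiStar, pureChi, this]

variable {M} in
theorem IsStop.starVal_pureChi {τ : Ω → ℕ} (hτ : IsStop M τ) (S : ℕ → Ω → ℝ) (t : ℕ) (ω : Ω) :
    starVal M (pureChi τ) S (t + 1) ω = if t < τ ω then S (τ ω) ω else 0 := by
  have := hτ.1 ω
  simp [starVal, pureChi, this]

variable {M} in
/-- Membership in `barP` for a pure stopping time, with the conditional expectation bounds
multiplied out by the probability of each atom. -/
theorem IsStop.memBarP_pureChi_iff {τ : Ω → ℕ} (hτ : IsStop M τ) {P : Ω → ℝ} {S : ℕ → Ω → ℝ} :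
    memBarP M (pureChi τ) P S ↔ (∀ ω, 0 ≤ P ω) ∧ (∑ ω, P ω) = 1 ∧ IsAdapted M S ∧
      (∀ t ω, t ≤ M.T → M.Sb t ω ≤ S t ω ∧ S t ω ≤ M.Sa t ω) ∧
      ∀ t, t ≤ M.T → ∀ ω, t < τ ω →
        M.Sb t ω * ∑ ω' ∈ atom (M.F t) ω, P ω' ≤
            ∑ ω' ∈ atom (M.F t) ω, P ω' * S (τ ω') ω' ∧
          ∑ ω' ∈ atom (M.F t) ω, P ω' * S (τ ω') ω' ≤
            M.Sa t ω * ∑ ω' ∈ atom (M.F t) ω, P ω' := by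
  unfold memBarP
  refine and_congr_right fun hP => and_congr_right fun _ => and_congr_right fun _ =>
    and_congr_right fun _ => forall_congr' fun t => forall_congr' fun ht => ?_
  have hsum : ∀ ω, t < τ ω →
      ∑ ω' ∈ atom (M.F t) ω, P ω' * starVal M (pureChi τ) S (t + 1) ω' =
        ∑ ω' ∈ atom (M.F t) ω, P ω' * S (τ ω') ω' := fun ω hω =>
    Finset.sum_congr rfl fun ω' hω' => by
      rw [hτ.starVal_pureChi, if_pos ((hτ.lt_iff_of_sameAtom (mem_atom.1 hω')).1 hω)]
  have hpos : ∀ ω, 0 < P ω → 0 < ∑ ω' ∈ atom (M.F t) ω, P ω' := fun ω hω =>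
    Finset.sum_pos' (fun ω' _ => hP ω') ⟨ω, mem_atom.2 (sameAtom_refl _ ω), hω⟩
  constructor
  · intro h ω hω
    by_cases h0 : ∀ ω' ∈ atom (M.F t) ω, P ω' = 0
    · rw [Finset.sum_eq_zero h0, Finset.sum_eq_zero fun ω' hω' => by rw [h0 ω' hω', zero_mul]]
      simp
    · push Not at h0
      obtain ⟨ω₀, hω₀, hne⟩ := h0
      have hP₀ : 0 < P ω₀ := (hP ω₀).lt_of_ne' hne
      have hsame := mem_atom.1 hω₀
      have hlt := (hτ.lt_iff_of_sameAtom hsame).1 hω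
      have := h ω₀ hP₀
      rw [hτ.chiStar_pureChi, if_pos hlt, one_mul, one_mul, condExp_eq, hsum ω₀ hlt,
        le_div_iff₀ (hpos ω₀ hP₀), div_le_iff₀ (hpos ω₀ hP₀), ← hsame.atom_eq,
        ← measurable_iff_sameAtom.1 (M.Sb_adapted t ht) _ _ hsame,
        ← measurable_iff_sameAtom.1 (M.Sa_adapted t ht) _ _ hsame] at this
      exact this
  · intro h ω hω
    rw [hτ.chiStar_pureChi]
    split_ifs with hlt
    · rw [one_mul, one_mul, condExp_eq, hsum ω hlt, le_div_iff₀ (hpos ω hω),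
        div_le_iff₀ (hpos ω hω)]
      exact h ω hlt
    · rw [condExp_eq, Finset.sum_eq_zero fun ω' hω' => by
        rw [hτ.starVal_pureChi,
          if_neg (mt (hτ.lt_iff_of_sameAtom (mem_atom.1 hω')).2 hlt), mul_zero]]
      simp

variable {M} in
/-- Optional stopping: an arbitrage-free model admits an approximate martingale for every
stopping time. -/
theorem ArbitrageFree.exists_memBarP (hNA : ArbitrageFree M) {τ : Ω → ℕ} (hτ : IsStop M τ) :
    ∃ P S, memBarP M (pureChi τ) P S := by
  obtain ⟨P, S, hP, hP1, hS, hbd, hmart⟩ := hNA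
  refine ⟨P, S, hτ.memBarP_pureChi_iff.2 ⟨fun ω => (hP ω).le, hP1, hS, hbd, ?_⟩⟩
  intro t ht ω hω
  have hstep : ∀ s, t ≤ s → s < M.T →
      ∑ ω' ∈ atom (M.F t) ω, P ω' * S (min (s + 1) (τ ω')) ω' =
        ∑ ω' ∈ atom (M.F t) ω, P ω' * S (min s (τ ω')) ω' := by
    classical
    intro s hts hsT
    rw [← sub_eq_zero, ← Finset.sum_sub_distrib, ← Finset.univ_inter (atom (M.F t) ω),
      ← Finset.sum_ite_mem]
    refine sum_eq_zero_of_sum_atom_eq_zero (M.F s) fun ω₀ => ?_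
    by_cases hω₀ : ω₀ ∈ atom (M.F t) ω ∧ s < τ ω₀
    · have hm := hmart s hsT ω₀ (hP ω₀)
      rw [condExp_eq, div_eq_iff (Finset.sum_pos (fun ω' _ => hP ω')
        ⟨ω₀, mem_atom.2 (sameAtom_refl _ ω₀)⟩).ne', Finset.mul_sum, ← sub_eq_zero,
        ← Finset.sum_sub_distrib] at hm
      rw [← hm]
      refine Finset.sum_congr rfl fun ω' hω' => ?_
      have hsame := mem_atom.1 hω'
      have hlt := (hτ.lt_iff_of_sameAtom hsame).1 hω₀.2
      rw [if_pos (mem_atom.2 ((mem_atom.1 hω₀.1).trans (hsame.mono (M.F_mono hts)))),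
        min_eq_left (Nat.succ_le_of_lt hlt), min_eq_left hlt.le,
        measurable_iff_sameAtom.1 (hS s hsT.le) _ _ hsame]
      ring
    · refine Finset.sum_eq_zero fun ω' hω' => ?_
      have hsame := mem_atom.1 hω'
      split_ifs with hmem
      · have hnlt : ¬ s < τ ω' := fun hlt => hω₀
          ⟨mem_atom.2 ((mem_atom.1 hmem).trans (hsame.symm.mono (M.F_mono hts))),
            (hτ.lt_iff_of_sameAtom hsame).2 hlt⟩
        rw [min_eq_right (by omega), min_eq_right (by omega), sub_self]
      · rfl
  have hconst : ∀ s, t ≤ s → s ≤ M.T →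
      ∑ ω' ∈ atom (M.F t) ω, P ω' * S (min s (τ ω')) ω' =
        ∑ ω' ∈ atom (M.F t) ω, P ω' * S (min t (τ ω')) ω' := by
    intro s hts
    induction s, hts using Nat.le_induction with
    | base => exact fun _ => rfl
    | succ s hts ih => exact fun hs => (hstep s hts hs).trans (ih (Nat.le_of_succ_le hs))
  have hval : ∑ ω' ∈ atom (M.F t) ω, P ω' * S (τ ω') ω' =
      S t ω * ∑ ω' ∈ atom (M.F t) ω, P ω' := by
    calc
      _ = ∑ ω' ∈ atom (M.F t) ω, P ω' * S (min M.T (τ ω')) ω' := by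
        simp only [min_eq_right (hτ.1 _)]
      _ = _ := hconst M.T ht le_rfl
      _ = _ := by
        rw [Finset.mul_sum]
        refine Finset.sum_congr rfl fun ω' hω' => ?_
        have hsame := mem_atom.1 hω'
        rw [min_eq_left ((hτ.lt_iff_of_sameAtom hsame).1 hω).le,
          measurable_iff_sameAtom.1 (hS t ht) _ _ hsame, mul_comm]
  have hnn : 0 ≤ ∑ ω' ∈ atom (M.F t) ω, P ω' := Finset.sum_nonneg fun ω' _ => (hP ω').le
  rw [hval]
  exact ⟨mul_le_mul_of_nonneg_right (hbd t ω ht).1 hnn,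
    mul_le_mul_of_nonneg_right (hbd t ω ht).2 hnn⟩

variable {M} in
theorem ArbitrageFree.exists_expect_min (hNA : ArbitrageFree M) {τ : Ω → ℕ} (hτ : IsStop M τ)
    (ξ ζ : ℕ → Ω → ℝ) :
    ∃ P S, memBarP M (pureChi τ) P S ∧ ∀ P' S', memBarP M (pureChi τ) P' S' →
      expect P (fun ω => ξ (τ ω) ω + S (τ ω) ω * ζ (τ ω) ω) ≤
        expect P' (fun ω => ξ (τ ω) ω + S' (τ ω) ω * ζ (τ ω) ω) := by
  -- Processes vanishing after time `T` suffice, and these form a compact set.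
  let trunc : (ℕ → Ω → ℝ) → ℕ → Ω → ℝ := fun S t ω => if t ≤ M.T then S t ω else 0
  have htrunc : ∀ S t ω, t ≤ M.T → trunc S t ω = S t ω := fun S t ω ht => if_pos ht
  have hmem : ∀ P S, memBarP M (pureChi τ) P S → memBarP M (pureChi τ) P (trunc S) := by
    intro P S h
    rw [hτ.memBarP_pureChi_iff] at h ⊢
    obtain ⟨h₁, h₂, h₃, h₄, h₅⟩ := h
    refine ⟨h₁, h₂, fun t ht => ?_, fun t ω ht => ?_, ?_⟩
    · have : trunc S t = S t := funext fun ω => htrunc S t ω ht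
      rw [this]
      exact h₃ t ht
    · rw [htrunc S t ω ht]
      exact h₄ t ω ht
    · simpa only [htrunc S _ _ (hτ.1 _)] using h₅
  let K : Set ((Ω → ℝ) × (ℕ → Ω → ℝ)) := Set.Icc 0 1 ×ˢ Set.Icc (trunc M.Sb) (trunc M.Sa)
  let C : Set ((Ω → ℝ) × (ℕ → Ω → ℝ)) := {p | memBarP M (pureChi τ) p.1 p.2}
  have hK : IsCompact K := isCompact_Icc.prod isCompact_Icc
  have hev : ∀ t ω, Continuous fun p : (Ω → ℝ) × (ℕ → Ω → ℝ) => p.2 t ω := fun t ω => by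
    fun_prop
  have hC : IsClosed C := by
    simp only [C, hτ.memBarP_pureChi_iff, IsAdapted, measurable_iff_sameAtom, Set.ofPred_and,
      Set.ofPred_forall]
    refine IsClosed.inter ?_ (IsClosed.inter ?_ (IsClosed.inter ?_ (IsClosed.inter ?_ ?_)))
    · exact isClosed_iInter fun ω => isClosed_le (by fun_prop) (by fun_prop)
    · exact isClosed_eq (by fun_prop) (by fun_prop)
    · exact isClosed_iInter fun t => isClosed_iInter fun _ => isClosed_iInter fun ω =>
        isClosed_iInter fun ω' => isClosed_iInter fun _ => isClosed_eq (hev t ω) (hev t ω')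
    · exact isClosed_iInter fun t => isClosed_iInter fun ω => isClosed_iInter fun _ =>
        (isClosed_le continuous_const (hev t ω)).inter (isClosed_le (hev t ω) continuous_const)
    · exact isClosed_iInter fun t => isClosed_iInter fun _ => isClosed_iInter fun ω =>
        isClosed_iInter fun _ =>
          (isClosed_le (by fun_prop) (by fun_prop)).inter (isClosed_le (by fun_prop) (by fun_prop))
  have hKmem : ∀ P S, memBarP M (pureChi τ) P S → (P, trunc S) ∈ K ∩ C := by
    refine fun P S h => ⟨⟨⟨h.1, fun ω => ?_⟩, fun t ω => ?_, fun t ω => ?_⟩, hmem P S h⟩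
    · rw [Pi.one_apply, ← h.2.1]
      exact Finset.single_le_sum (fun ω' _ => h.1 ω') (Finset.mem_univ ω)
    all_goals
      by_cases ht : t ≤ M.T
      · have := h.2.2.2.1 t ω ht
        simp [trunc, ht, this]
      · simp [trunc, ht]
  obtain ⟨P₀, S₀, h₀⟩ := hNA.exists_memBarP hτ
  obtain ⟨⟨P, S⟩, hPS, hmin⟩ := (hK.inter_right hC).exists_isMinOn ⟨_, hKmem P₀ S₀ h₀⟩
    (f := fun p => expect p.1 fun ω => ξ (τ ω) ω + p.2 (τ ω) ω * ζ (τ ω) ω) (by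
      unfold expect
      fun_prop)
  refine ⟨P, S, hPS.2, fun P' S' h' => ?_⟩
  have := isMinOn_iff.1 hmin _ (hKmem P' S' h')
  simpa only [htrunc S' _ _ (hτ.1 _)] using this

variable {M} in
/-- Exercising along a superhedging portfolio process `X` of (cash, stock) pairs yields at least
the negative of its initial cost under every approximate martingale. -/
theorem IsStop.neg_le_expect_of_hedge {τ : Ω → ℕ} (hτ : IsStop M τ) {ξ ζ : ℕ → Ω → ℝ}
    {X : ℕ → Ω → ℝ × ℝ} {x : ℝ} (hX₀ : ∀ ω, X 0 ω = (x, 0))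
    (hXad : ∀ t ω ω', t < M.T → sameAtom (M.F t) ω ω' →
      X t ω = X t ω' ∧ X (t + 1) ω = X (t + 1) ω')
    (hXτ : ∀ ω, X (τ ω) ω ∈ epi (uBuy M ξ ζ (τ ω) ω))
    (hXstep : ∀ t ω, t < τ ω → X t ω - X (t + 1) ω ∈ epi (hfun (M.Sb t ω) (M.Sa t ω)))
    {P : Ω → ℝ} {S : ℕ → Ω → ℝ} (hPS : memBarP M (pureChi τ) P S) :
    -x ≤ expect P (fun ω => ξ (τ ω) ω + S (τ ω) ω * ζ (τ ω) ω) := by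
  obtain ⟨hP, hP1, -, hbd, hce⟩ := hτ.memBarP_pureChi_iff.1 hPS
  let V : ℕ → Ω → ℝ := fun t ω => P ω *
    ((X (min t (τ ω)) ω).1 + (X (min t (τ ω)) ω).2 * S (τ ω) ω)
  have hstep : ∀ t, t < M.T → ∑ ω, V (t + 1) ω ≤ ∑ ω, V t ω := by
    intro t ht
    rw [← sub_nonneg, ← Finset.sum_sub_distrib]
    refine sum_nonneg_of_sum_atom_nonneg (M.F t) fun ω => ?_
    by_cases hω : t < τ ω
    · have hcongr : ∑ ω' ∈ atom (M.F t) ω, (V t ω' - V (t + 1) ω') =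
          (X t ω - X (t + 1) ω).1 * ∑ ω' ∈ atom (M.F t) ω, P ω' +
            (X t ω - X (t + 1) ω).2 * ∑ ω' ∈ atom (M.F t) ω, P ω' * S (τ ω') ω' := by
        rw [Finset.mul_sum, Finset.mul_sum, ← Finset.sum_add_distrib]
        refine Finset.sum_congr rfl fun ω' hω' => ?_
        have hsame := mem_atom.1 hω'
        have hlt := (hτ.lt_iff_of_sameAtom hsame).1 hω
        simp only [V]
        rw [min_eq_left (Nat.succ_le_of_lt hlt), min_eq_left hlt.le, (hXad t _ _ ht hsame).1,
          (hXad t _ _ ht hsame).2, Prod.fst_sub, Prod.snd_sub]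
        ring
      rw [hcongr]
      obtain ⟨hlo, hhi⟩ := hce t ht.le ω hω
      have hh : hfun _ _ _ ≤ _ := hXstep t ω hω
      have hnn : 0 ≤ ∑ ω' ∈ atom (M.F t) ω, P ω' := Finset.sum_nonneg fun ω' _ => hP ω'
      generalize X t ω - X (t + 1) ω = d at hh ⊢
      generalize ∑ ω' ∈ atom (M.F t) ω, P ω' = p at *
      generalize ∑ ω' ∈ atom (M.F t) ω, P ω' * S (τ ω') ω' = q at *
      have hdp := mul_le_mul_of_nonneg_right hh hnn
      unfold hfun at hdp
      rcases le_total 0 d.2 with h0 | h0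
      · rw [max_eq_left h0, max_eq_right (neg_nonpos.2 h0)] at hdp
        nlinarith
      · rw [max_eq_right h0, max_eq_left (neg_nonneg.2 h0)] at hdp
        nlinarith
    · refine Finset.sum_nonneg fun ω' hω' => ?_
      have := mt (hτ.lt_iff_of_sameAtom (mem_atom.1 hω')).2 hω
      simp only [V]
      rw [min_eq_right (by omega), min_eq_right (by omega), sub_self]
  have hdecr : ∀ t, t ≤ M.T → ∑ ω, V t ω ≤ ∑ ω, V 0 ω := by
    intro t
    induction t with
    | zero => exact fun _ => le_rfl
    | succ t ih => exact fun ht => (hstep t ht).trans (ih (Nat.le_of_succ_le ht))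
  have hV₀ : ∑ ω, V 0 ω = x := by
    simp [V, hX₀, ← Finset.sum_mul, hP1]
  have hVT : -∑ ω, V M.T ω ≤ expect P (fun ω => ξ (τ ω) ω + S (τ ω) ω * ζ (τ ω) ω) := by
    rw [expect, ← Finset.sum_neg_distrib]
    refine Finset.sum_le_sum fun ω _ => ?_
    simp only [V]
    rw [min_eq_right (hτ.1 ω), ← mul_neg]
    refine mul_le_mul_of_nonneg_left ?_ (hP ω)
    have hu : uBuy M ξ ζ _ _ _ ≤ _ := hXτ ω
    obtain ⟨hb, ha⟩ := hbd (τ ω) ω (hτ.1 ω)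
    unfold uBuy at hu
    generalize X (τ ω) ω = d at hu ⊢
    rcases le_total 0 (d.2 + ζ (τ ω) ω) with h0 | h0
    · rw [max_eq_left h0, max_eq_right (neg_nonpos.2 h0)] at hu
      nlinarith
    · rw [max_eq_right h0, max_eq_left (neg_nonneg.2 h0)] at hu
      nlinarith
  linarith [hdecr M.T le_rfl]

/-- A portfolio in `B` reachable from `p` by a rebalancing whose difference lies in `A`,
if there is one. -/
def rebalance (A B : Set (ℝ × ℝ)) (p : ℝ × ℝ) : ℝ × ℝ :=
  Classical.epsilon fun q => q ∈ B ∧ p - q ∈ A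

theorem rebalance_spec {A B : Set (ℝ × ℝ)} {p : ℝ × ℝ} (hp : p ∈ A + B) :
    rebalance A B p ∈ B ∧ p - rebalance A B p ∈ A := by
  obtain ⟨a, ha, b, hb, rfl⟩ := hp
  exact Classical.epsilon_spec (p := fun q => q ∈ B ∧ a + b - q ∈ A) ⟨b, hb, by simpa using ha⟩

/-- The buyer's portfolio process constructed forwards from the pricing recursion `z`. -/
def buyerPortfolio (z : ℕ → Ω → ℝ → ℝ) : ℕ → Ω → ℝ × ℝ
  | 0, ω => (z 0 ω 0, 0)
  | t + 1, ω => rebalance (epi (hfun (M.Sb t ω) (M.Sa t ω)))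
      (⋂ ω' ∈ {ω'' | sameAtom (M.F t) ω ω''}, epi (z (t + 1) ω')) (buyerPortfolio z t ω)

variable {M} in
theorem buyerPortfolio_eq_of_sameAtom {ξ ζ : ℕ → Ω → ℝ} {z : ℕ → Ω → ℝ → ℝ}
    (hz : BuyerRec M ξ ζ z) (t : ℕ) (ht : t < M.T) {ω ω' : Ω} (h : sameAtom (M.F t) ω ω') :
    buyerPortfolio M z t ω = buyerPortfolio M z t ω' ∧
      buyerPortfolio M z (t + 1) ω = buyerPortfolio M z (t + 1) ω' := by
  have hsucc : ∀ t, t < M.T → sameAtom (M.F t) ω ω' →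
      buyerPortfolio M z t ω = buyerPortfolio M z t ω' →
        buyerPortfolio M z (t + 1) ω = buyerPortfolio M z (t + 1) ω' := fun t ht h heq => by
    rw [buyerPortfolio, buyerPortfolio, heq, h.setOf_eq,
      measurable_iff_sameAtom.1 (M.Sb_adapted t ht.le) _ _ h,
      measurable_iff_sameAtom.1 (M.Sa_adapted t ht.le) _ _ h]
  have heq : buyerPortfolio M z t ω = buyerPortfolio M z t ω' := by
    induction t with
    | zero => rw [buyerPortfolio, buyerPortfolio, hz.1 0 ω ω' (Nat.zero_le _) h]
    | succ t ih =>
      have h' := h.mono (M.F_mono t.le_succ)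
      exact hsucc t (by omega) h' (ih (by omega) h')
  exact ⟨heq, hsucc t ht h heq⟩

variable {M} in
/-- The first time at which the buyer's portfolio allows exercise is a stopping time before which
the portfolio is rebalanced in a self-financing way. -/
theorem BuyerRec.exists_isStop {ξ ζ : ℕ → Ω → ℝ} (hpay : AdaptedPair M ξ ζ)
    {z : ℕ → Ω → ℝ → ℝ} (hz : BuyerRec M ξ ζ z) :
    ∃ τ, IsStop M τ ∧
      (∀ ω, buyerPortfolio M z (τ ω) ω ∈ epi (uBuy M ξ ζ (τ ω) ω)) ∧
      ∀ t ω, t < τ ω → buyerPortfolio M z t ω - buyerPortfolio M z (t + 1) ω ∈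
        epi (hfun (M.Sb t ω) (M.Sa t ω)) := by
  classical
  set X := buyerPortfolio M z
  let E : ℕ → Ω → Prop := fun t ω => X t ω ∈ epi (uBuy M ξ ζ t ω)
  have hcont : ∀ t ω, t < M.T → X t ω ∈ epi (z t ω) → ¬ E t ω →
      X (t + 1) ω ∈ epi (z (t + 1) ω) ∧
        X t ω - X (t + 1) ω ∈ epi (hfun (M.Sb t ω) (M.Sa t ω)) := by
    intro t ω ht hmem hE
    rw [hz.2.2 t ω ht] at hmem
    have hspec := rebalance_spec (hmem.resolve_left hE)
    exact ⟨Set.mem_iInter₂.1 hspec.1 ω (sameAtom_refl _ ω), hspec.2⟩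
  have hinv : ∀ ω t, t ≤ M.T → (∀ s < t, ¬ E s ω) → X t ω ∈ epi (z t ω) := by
    intro ω t
    induction t with
    | zero => exact fun _ _ => le_refl (z 0 ω 0)
    | succ t ih =>
      exact fun ht hs => (hcont t ω ht (ih (by omega) fun s hst => hs s (by omega))
        (hs t (by omega))).1
  have hex : ∀ ω, ∃ t, t ≤ M.T ∧ E t ω := by
    intro ω
    by_contra! h
    refine h M.T le_rfl ?_
    have := hinv ω M.T le_rfl fun s hs => h s hs.le
    rwa [hz.2.1 ω] at this
  have hEad : ∀ t ω ω', t ≤ M.T → sameAtom (M.F t) ω ω' → E t ω → E t ω' := by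
    intro t ω ω' ht h hE
    have hX : X t ω = X t ω' := by
      rcases t with - | t
      · exact (buyerPortfolio_eq_of_sameAtom hz 0 M.T_pos h).1
      · exact (buyerPortfolio_eq_of_sameAtom hz t ht (h.mono (M.F_mono t.le_succ))).2
    simp only [E, epi, uBuy, Set.mem_ofPred_eq] at hE ⊢
    rwa [← hX, ← measurable_iff_sameAtom.1 (M.Sb_adapted t ht) _ _ h,
      ← measurable_iff_sameAtom.1 (M.Sa_adapted t ht) _ _ h,
      ← measurable_iff_sameAtom.1 (hpay.1 t ht) _ _ h,
      ← measurable_iff_sameAtom.1 (hpay.2 t ht) _ _ h]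
  refine ⟨fun ω => Nat.find (hex ω), ⟨fun ω => (Nat.find_spec (hex ω)).1, fun t => ?_⟩,
    fun ω => (Nat.find_spec (hex ω)).2, fun t ω ht => ?_⟩
  · refine measurableSet_of_sameAtom fun ω ω' h hω => ?_
    simp only [Set.mem_ofPred_eq, Nat.find_eq_iff] at hω ⊢
    obtain ⟨⟨htT, hEt⟩, hlt⟩ := hω
    refine ⟨⟨htT, hEad t ω ω' htT h hEt⟩, fun s hs hEs => hlt s hs ⟨hEs.1, ?_⟩⟩
    exact hEad s ω' ω hEs.1 (h.symm.mono (M.F_mono hs.le)) hEs.2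
  · replace ht : t < Nat.find (hex ω) := ht
    have hT : Nat.find (hex ω) ≤ M.T := (Nat.find_spec (hex ω)).1
    have hnot : ∀ s ≤ t, ¬ E s ω := fun s hs hE =>
      Nat.find_min (hex ω) (hs.trans_lt ht) ⟨by omega, hE⟩
    exact (hcont t ω (by omega) (hinv ω t (by omega) fun s hs => hnot s hs.le)
      (hnot t le_rfl)).2

/-- Lemma (buyer's stopping time and approximate martingale): there exist a pure
stopping time τ̌ and (P̌,Š) ∈ barP(τ̌) attaining the minimum over barP(τ̌), whose
expectation is ≥ −z₀(0) for the buyer's pricing recursion z. -/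
theorem buyer_stop_approx_martingale (ξ ζ : ℕ → Ω → ℝ)
    (hpay : AdaptedPair M ξ ζ) (hNA : ArbitrageFree M)
    (z : ℕ → Ω → ℝ → ℝ) (hz : BuyerRec M ξ ζ z) :
    ∃ τ P S, IsStop M τ ∧ memBarP M (pureChi τ) P S ∧
      (∀ P' S', memBarP M (pureChi τ) P' S' →
        expect P (fun ω => ξ (τ ω) ω + S (τ ω) ω * ζ (τ ω) ω) ≤
          expect P' (fun ω => ξ (τ ω) ω + S' (τ ω) ω * ζ (τ ω) ω)) ∧
      ∀ ω, -(z 0 ω 0) ≤ expect P (fun ω' => ξ (τ ω') ω' + S (τ ω') ω' * ζ (τ ω') ω') := by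
  obtain ⟨τ, hτ, hexercise, hstep⟩ := hz.exists_isStop hpay
  obtain ⟨P, S, hPS, hmin⟩ := hNA.exists_expect_min hτ ξ ζ
  refine ⟨τ, P, S, hτ, hPS, hmin, fun ω => ?_⟩
  refine hτ.neg_le_expect_of_hedge (X := buyerPortfolio M z) (fun ω' => ?_)
    (fun t _ _ ht h => buyerPortfolio_eq_of_sameAtom hz t ht h) hexercise hstep hPS
  have h : sameAtom (M.F 0) ω' ω := fun A hA => by
    rw [M.F_zero, MeasurableSpace.measurableSet_bot_iff] at hA
    rcases hA with rfl | rfl <;> simp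
  rw [buyerPortfolio, hz.1 0 ω' ω (Nat.zero_le _) h]

end RZ
end
end
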